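/- arXiv:2402.18910 — 5 statements merged into one kernel-verified Lean document; each statement's English description precedes it below -/
import Mathlib

section
/- Let X, A, Y be nonempty standard Borel measurable spaces, κ a Markov kernel from X to A (the expert policy), η a Markov kernel from X × A to Y (the outcome mechanism), and μ, ν probability measures on X (the original and shifted covariate distributions) with ν absolutely continuous with respect to μ. Let π be the conditional kernel (disintegration) of the joint measure μ ⊗ₘ κ on X × A with respect to its first marginal (the behavior-cloning policy). Then the outcome distribution under the cloned policy in the shifted domain equals the outcome distribution under the expert policy: (ν ⊗ₘ π) ∘ₘ η = (ν ⊗ₘ κ) ∘ₘ η. -/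
open MeasureTheory ProbabilityTheory

/-- **Domain generalizability of the behavior-cloning policy** (measure-theoretic form of
Theorem 1). Let `κ` be the expert policy (a Markov kernel from covariates `X` to actions `A`),
`η` the outcome mechanism (a Markov kernel from `X × A` to outcomes `Y`), `μ` the original
covariate distribution and `ν` a shifted covariate distribution with `ν ≪ μ`. The
behavior-cloning policy `π = (μ ⊗ₘ κ).condKernel` yields the same outcome distribution as the
expert policy in the shifted domain: `(ν ⊗ₘ π) ∘ₘ η = (ν ⊗ₘ κ) ∘ₘ η`. -/
theorem bc_policy_domain_generalizable_outcome
    {X A Y : Type*}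
    [MeasurableSpace X] [StandardBorelSpace X] [Nonempty X]
    [MeasurableSpace A] [StandardBorelSpace A] [Nonempty A]
    [MeasurableSpace Y] [StandardBorelSpace Y] [Nonempty Y]
    (κ : Kernel X A) [IsMarkovKernel κ]
    (η : Kernel (X × A) Y) [IsMarkovKernel η]
    (μ ν : Measure X) [IsProbabilityMeasure μ] [IsProbabilityMeasure ν]
    (hac : ν ≪ μ) :
    (ν ⊗ₘ (μ ⊗ₘ κ).condKernel).bind η = (ν ⊗ₘ κ).bind η := by
  rw [Measure.compProd_congr (hac.ae_le (condKernel_compProd μ κ))]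
end

section
/- Let X, Z, A be nonempty standard Borel measurable spaces, μ a probability measure on X × Z (the covariates), and κ a Markov kernel from X to A (a policy depending only on X). Let ρ be the probability measure on (X × Z) × A obtained by composing μ with the kernel that sends (x,z) to κ(x) (κ pulled back along the first projection). Then, on the probability space ((X × Z) × A, ρ), the projection onto A is conditionally independent of the projection onto Z given the projection onto X. -/
open MeasureTheory ProbabilityTheory

/-- Pushing the source coordinate of `μ ⊗ₘ κ.comap f` forward along `f` gives `μ.map f ⊗ₘ κ`. -/
lemma map_prodMap_compProd_comap {α β γ : Type*} [MeasurableSpace α] [MeasurableSpace β]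
    [MeasurableSpace γ] (μ : Measure α) [SFinite μ] (κ : Kernel β γ) [IsSFiniteKernel κ]
    {f : α → β} (hf : Measurable f) :
    (μ ⊗ₘ κ.comap f hf).map (Prod.map f id) = μ.map f ⊗ₘ κ := by
  ext s hs
  have hfid : Measurable (Prod.map f (id : γ → γ)) := hf.prodMap measurable_id
  rw [Measure.map_apply hfid hs, Measure.compProd_apply (hfid hs), Measure.compProd_apply hs,
    lintegral_map (Kernel.measurable_kernel_prodMk_left hs) hf]
  rfl

/-- If `Y` is generated by a kernel that depends on `a` only through `f a`, then that kernel is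
the conditional distribution of `Y` given `f`. -/
lemma condDistrib_snd_compProd_comap {α β γ : Type*} [MeasurableSpace α] [MeasurableSpace β]
    [MeasurableSpace γ] [StandardBorelSpace γ] [Nonempty γ] (μ : Measure α) [IsFiniteMeasure μ]
    (κ : Kernel β γ) [IsMarkovKernel κ] {f : α → β} (hf : Measurable f) :
    condDistrib Prod.snd (fun ω ↦ f ω.1) (μ ⊗ₘ κ.comap f hf) =ᵐ[μ.map f] κ := by
  have h_map : (μ ⊗ₘ κ.comap f hf).map (fun ω ↦ f ω.1) = μ.map f := by
    rw [← Function.comp_def, ← Measure.map_map hf measurable_fst, ← Measure.fst,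
      Measure.fst_compProd]
  have h := condDistrib_ae_eq_of_measure_eq_compProd (μ := μ ⊗ₘ κ.comap f hf) (κ := κ)
    (fun ω ↦ f ω.1) measurable_snd.aemeasurable
    (by rw [h_map]; exact map_prodMap_compProd_comap μ κ hf)
  rwa [h_map] at h

/-- If the expert action is generated from its direct cause `X` alone (via the policy kernel
`κ : Kernel X A`, pulled back along the first projection of the covariate space `X × Z`), then
under the resulting joint law `ρ = μ ⊗ₘ (κ.comap Prod.fst)` on `(X × Z) × A`, the action
(projection onto `A`) is conditionally independent of every other covariate (projection onto
`Z`) given `X` (the σ-algebra generated by the projection onto `X`). -/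
theorem action_condIndep_of_policy_depends_only_on_direct_cause
    {X Z A : Type*}
    [MeasurableSpace X] [StandardBorelSpace X] [Nonempty X]
    [MeasurableSpace Z] [StandardBorelSpace Z] [Nonempty Z]
    [MeasurableSpace A] [StandardBorelSpace A] [Nonempty A]
    (μ : Measure (X × Z)) [IsProbabilityMeasure μ]
    (κ : Kernel X A) [IsMarkovKernel κ] :
    CondIndepFun
      (MeasurableSpace.comap (fun ω : (X × Z) × A => ω.1.1) inferInstance)
      ((measurable_fst.comp measurable_fst).comap_le)
      (fun ω : (X × Z) × A => ω.2)
      (fun ω : (X × Z) × A => ω.1.2)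
      (μ ⊗ₘ κ.comap Prod.fst measurable_fst) := by
  refine CondIndepFun.symm ?_
  have hX : Measurable fun ω : (X × Z) × A ↦ ω.1.1 := measurable_fst.comp measurable_fst
  refine (condIndepFun_iff_condDistrib_prod_ae_eq_prodMkRight measurable_snd
    (measurable_snd.comp measurable_fst) hX).2 ?_
  have h_fst : (μ ⊗ₘ κ.comap Prod.fst measurable_fst).map (fun ω ↦ (ω.1.1, ω.1.2)) = μ :=
    Measure.fst_compProd μ _
  have h_joint := condDistrib_snd_compProd_comap μ (κ.comap Prod.fst measurable_fst) measurable_id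
  have h_X := ae_of_ae_map measurable_fst.aemeasurable
    (condDistrib_snd_compProd_comap μ κ measurable_fst)
  rw [Measure.map_id] at h_joint
  rw [Function.comp_def, h_fst]
  filter_upwards [h_joint, h_X] with p hp hpX
  rw [Kernel.prodMkRight_apply]
  exact hp.trans hpX.symm
end

section
/- In the finite Bayesian network setting, for each index i the ordered local Markov property holds: let B = {j : j < i and j ∉ pa(i)}. Then under p, the coordinate X_i is conditionally independent of the family (X_j)_{j ∈ B} given the parents (X_j)_{j ∈ pa(i)}; that is, for every configuration c of pa(i) with marginal p_{pa(i)}(c) > 0, every value a of α i, and every configuration b of B, one has p(X_i = a, X_B = b | X_{pa(i)} = c) = p(X_i = a | X_{pa(i)} = c) · p(X_B = b | X_{pa(i)} = c). -/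
open scoped NNReal

namespace BayesNet

/-- Resampling one coordinate uniformly multiplies the total sum by the number of its values. -/
theorem sum_sum_update {ι : Type*} [Fintype ι] [DecidableEq ι] {α : ι → Type*}
    [∀ i, Fintype (α i)] {M : Type*} [Semiring M] (i : ι) (G : (∀ j, α j) → M) :
    ∑ x, ∑ a, G (Function.update x i a) = (Fintype.card (α i) : M) * ∑ x, G x := by
  have hinv : Function.Involutive
      (fun q : (∀ j, α j) × α i => (Function.update q.1 i q.2, q.1 i)) := by
    rintro ⟨x, a⟩
    simp
  calc ∑ x, ∑ a, G (Function.update x i a)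
      = ∑ q : (∀ j, α j) × α i, G (Function.update q.1 i q.2) := by
        rw [Fintype.sum_prod_type]
    _ = ∑ q : (∀ j, α j) × α i, G q.1 :=
        Equiv.sum_comp hinv.toPerm (fun q : (∀ j, α j) × α i => G q.1)
    _ = (Fintype.card (α i) : M) * ∑ x, G x := by
        rw [Fintype.sum_prod_type]
        simp [Finset.mul_sum]

variable {n : ℕ} {α : Fin n → Type*} {pa : Fin n → Finset (Fin n)}

/-- The product of the conditional probabilities of the coordinates with index below `m`. -/
def truncatedWeight (k : ∀ i : Fin n, ((j : pa i) → α j) → α i → ℝ≥0) (m : ℕ)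
    (x : ∀ i, α i) : ℝ≥0 :=
  ∏ i : Fin n with i.val < m, k i (fun j : pa i => x j) (x i)

theorem truncatedWeight_succ_update (hpa : ∀ i : Fin n, ∀ j ∈ pa i, j < i)
    (k : ∀ i : Fin n, ((j : pa i) → α j) → α i → ℝ≥0) (i : Fin n) (x : ∀ i, α i) (a : α i) :
    truncatedWeight k (i.val + 1) (Function.update x i a) =
      k i (fun j : pa i => x j) a * truncatedWeight k i.val x := by
  have hset : (Finset.univ.filter fun j : Fin n => j.val < i.val + 1) =
      insert i (Finset.univ.filter fun j : Fin n => j.val < i.val) := by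
    ext j
    simp only [Finset.mem_filter, Finset.mem_univ, true_and, Finset.mem_insert, Fin.ext_iff]
    omega
  have hparents : ∀ j : Fin n, j ≤ i →
      (fun l : pa j => Function.update x i a l) = fun l : pa j => x l := by
    intro j hj
    funext l
    exact Function.update_of_ne ((hpa j l l.2).trans_le hj).ne _ _
  rw [truncatedWeight, hset, Finset.prod_insert (by simp), hparents i le_rfl,
    Function.update_self]
  congr 1
  refine Finset.prod_congr rfl fun j hj => ?_
  have hji : j < i := (Finset.mem_filter.mp hj).2
  rw [hparents j hji.le, Function.update_of_ne hji.ne]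

variable [∀ i, Fintype (α i)]

theorem card_mul_sum_truncatedWeight_succ (hpa : ∀ i : Fin n, ∀ j ∈ pa i, j < i)
    (k : ∀ i : Fin n, ((j : pa i) → α j) → α i → ℝ≥0) (i : Fin n) (F : (∀ i, α i) → ℝ≥0) :
    (Fintype.card (α i) : ℝ≥0) * ∑ x, F x * truncatedWeight k (i.val + 1) x =
      ∑ x, (∑ a, F (Function.update x i a) * k i (fun j : pa i => x j) a) *
        truncatedWeight k i.val x := by
  rw [← sum_sum_update i]
  simp only [truncatedWeight_succ_update hpa, Finset.sum_mul, mul_assoc]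

variable [∀ i, Nonempty (α i)]

/-- Functions of the coordinates below `l` with the same sum against the truncated weight at `l`
have the same sum against every longer truncated weight. -/
theorem sum_truncatedWeight_congr (hpa : ∀ i : Fin n, ∀ j ∈ pa i, j < i)
    (k : ∀ i : Fin n, ((j : pa i) → α j) → α i → ℝ≥0)
    (hk : ∀ (i : Fin n) (c : (j : pa i) → α j), ∑ a : α i, k i c a = 1)
    {F G : (∀ i, α i) → ℝ≥0} {l m : ℕ} (hlm : l ≤ m) (hmn : m ≤ n)
    (hF : ∀ (i : Fin n) (x : ∀ i, α i) (a : α i), l ≤ i.val → F (Function.update x i a) = F x)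
    (hG : ∀ (i : Fin n) (x : ∀ i, α i) (a : α i), l ≤ i.val → G (Function.update x i a) = G x)
    (h : ∑ x, F x * truncatedWeight k l x = ∑ x, G x * truncatedWeight k l x) :
    ∑ x, F x * truncatedWeight k m x = ∑ x, G x * truncatedWeight k m x := by
  induction m, hlm using Nat.le_induction with
  | base => exact h
  | succ m hlm ih =>
    let i : Fin n := ⟨m, hmn⟩
    have hcard : (Fintype.card (α i) : ℝ≥0) ≠ 0 := by simp
    have hstep : ∀ H : (∀ i, α i) → ℝ≥0,
        (∀ (i : Fin n) (x : ∀ i, α i) (a : α i), l ≤ i.val → H (Function.update x i a) = H x) →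
        (Fintype.card (α i) : ℝ≥0) * ∑ x, H x * truncatedWeight k (m + 1) x =
          ∑ x, H x * truncatedWeight k m x := by
      intro H hH
      have hsum := card_mul_sum_truncatedWeight_succ hpa k i H
      simpa only [hH i _ _ hlm, ← Finset.mul_sum, hk, mul_one] using hsum
    refine mul_left_cancel₀ hcard ?_
    rw [hstep F hF, hstep G hG]
    exact ih (Nat.le_of_succ_le hmn)

/-- Given the coordinates before `i`, the coordinate `i` has conditional law `k i`. -/
theorem sum_ite_eq_sum_mul [∀ i, DecidableEq (α i)] (hpa : ∀ i : Fin n, ∀ j ∈ pa i, j < i)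
    (k : ∀ i : Fin n, ((j : pa i) → α j) → α i → ℝ≥0)
    (hk : ∀ (i : Fin n) (c : (j : pa i) → α j), ∑ a : α i, k i c a = 1)
    (i : Fin n) (a : α i) (f : (∀ i, α i) → ℝ≥0)
    (hf : ∀ (j : Fin n) (x : ∀ i, α i) (a : α j), i ≤ j → f (Function.update x j a) = f x) :
    ∑ x, (if x i = a then f x else 0) * ∏ j : Fin n, k j (fun l : pa j => x l) (x j) =
      ∑ x, (f x * k i (fun l : pa i => x l) a) *
        ∏ j : Fin n, k j (fun l : pa j => x l) (x j) := by
  have hparents : ∀ (j : Fin n) (x : ∀ i, α i) (b : α j), i ≤ j →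
      (fun l : pa i => Function.update x j b l) = fun l : pa i => x l := by
    intro j x b hij
    funext l
    exact Function.update_of_ne ((hpa i l l.2).trans_le hij).ne _ _
  have hfull : ∀ x : ∀ i, α i,
      ∏ j : Fin n, k j (fun l : pa j => x l) (x j) = truncatedWeight k n x := by
    intro x
    simp [truncatedWeight]
  simp only [hfull]
  refine sum_truncatedWeight_congr hpa k hk (l := i.val + 1) i.isLt le_rfl ?_ ?_ ?_
  · intro j x b hij
    have hlt : i < j := hij
    rw [hf j x b hlt.le, Function.update_of_ne hlt.ne]
  · intro j x b hij
    have hlt : i < j := hij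
    rw [hf j x b hlt.le, hparents j x b hlt.le]
  · have hcard : (Fintype.card (α i) : ℝ≥0) ≠ 0 := by simp
    refine mul_left_cancel₀ hcard ?_
    rw [card_mul_sum_truncatedWeight_succ hpa, card_mul_sum_truncatedWeight_succ hpa]
    refine Finset.sum_congr rfl fun x _ => ?_
    simp only [hf i x _ le_rfl, hparents i x _ le_rfl, Function.update_self, ite_mul, zero_mul,
      Finset.sum_ite_eq', Finset.mem_univ, if_true, ← Finset.mul_sum, hk, mul_one]

/-- Given an event `E` on the coordinates before `i` that fixes the parents of `i` to `c`, the
coordinate `i` has conditional law `k i c`. -/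
theorem sum_filter_and_eq [∀ i, DecidableEq (α i)] (hpa : ∀ i : Fin n, ∀ j ∈ pa i, j < i)
    (k : ∀ i : Fin n, ((j : pa i) → α j) → α i → ℝ≥0)
    (hk : ∀ (i : Fin n) (c : (j : pa i) → α j), ∑ a : α i, k i c a = 1)
    (i : Fin n) (a : α i) (c : (j : pa i) → α j) (E : (∀ i, α i) → Prop) [DecidablePred E]
    (hE : ∀ (j : Fin n) (x : ∀ i, α i) (a : α j), i ≤ j → (E (Function.update x j a) ↔ E x))
    (hc : ∀ x, E x → ∀ j : pa i, x j = c j) :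
    ∑ x with x i = a ∧ E x, ∏ j : Fin n, k j (fun l : pa j => x l) (x j) =
      k i c a * ∑ x with E x, ∏ j : Fin n, k j (fun l : pa j => x l) (x j) := by
  have h := sum_ite_eq_sum_mul hpa k hk i a (fun x => if E x then 1 else 0)
    (fun j x b hij => by simp only [hE j x b hij])
  rw [Finset.mul_sum, Finset.sum_filter, Finset.sum_filter]
  calc _ = _ := Finset.sum_congr rfl fun x _ => ?_
    _ = _ := h
    _ = _ := Finset.sum_congr rfl fun x _ => ?_
  · simp only [ite_and, ite_mul, one_mul, zero_mul]
  · by_cases hx : E x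
    · have hcx : (fun l : pa i => x l) = c := funext (hc x hx)
      simp only [hx, if_true, one_mul, hcx]
    · simp [hx]

end BayesNet

/-- **Ordered local Markov property** for finite Bayesian networks. For each index `i`, let
`B = {j | j < i ∧ j ∉ pa i}` be the non-parent predecessors of `i`. Then under the joint
weight `p`, the coordinate `X_i` is conditionally independent of the family `(X_j)_{j ∈ B}`
given the parents `(X_j)_{j ∈ pa i}`: for every parent configuration `c` of positive marginal
mass, every value `a : α i` and every configuration `b` of `B`,
`p(X_i = a, X_B = b | X_{pa i} = c) = p(X_i = a | X_{pa i} = c) * p(X_B = b | X_{pa i} = c)`.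
Marginals are sums of `p` over agreeing configurations; conditionals are ratios of
marginals. -/
theorem bayesNet_ordered_local_markov
    {n : ℕ} (hn : 0 < n)
    {α : Fin n → Type*} [∀ i, Fintype (α i)] [∀ i, Nonempty (α i)] [∀ i, DecidableEq (α i)]
    (pa : Fin n → Finset (Fin n)) (hpa : ∀ i : Fin n, ∀ j ∈ pa i, j < i)
    (k : ∀ i : Fin n, ((j : pa i) → α j) → α i → ℝ≥0)
    (hk : ∀ (i : Fin n) (c : (j : pa i) → α j), ∑ a : α i, k i c a = 1)
    (p : (∀ i, α i) → ℝ≥0)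
    (hpdef : ∀ x : ∀ i, α i, p x = ∏ i : Fin n, k i (fun j : pa i => x j) (x i))
    (i : Fin n)
    (B : Finset (Fin n)) (hB : B = Finset.univ.filter (fun j => j < i ∧ j ∉ pa i))
    (c : (j : pa i) → α j)
    (hpos : 0 < ∑ x ∈ Finset.univ.filter (fun x : ∀ i', α i' => ∀ j : pa i, x j = c j), p x)
    (a : α i) (b : (j : B) → α j) :
    (∑ x ∈ Finset.univ.filter
        (fun x : ∀ i', α i' =>
          x i = a ∧ (∀ j : B, x j = b j) ∧ (∀ j : pa i, x j = c j)), p x) /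
      (∑ x ∈ Finset.univ.filter (fun x : ∀ i', α i' => ∀ j : pa i, x j = c j), p x) =
    ((∑ x ∈ Finset.univ.filter
        (fun x : ∀ i', α i' => x i = a ∧ (∀ j : pa i, x j = c j)), p x) /
      (∑ x ∈ Finset.univ.filter (fun x : ∀ i', α i' => ∀ j : pa i, x j = c j), p x)) *
    ((∑ x ∈ Finset.univ.filter
        (fun x : ∀ i', α i' => (∀ j : B, x j = b j) ∧ (∀ j : pa i, x j = c j)), p x) /
      (∑ x ∈ Finset.univ.filter (fun x : ∀ i', α i' => ∀ j : pa i, x j = c j), p x)) := by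
  have hB_lt : ∀ j : B, (j : Fin n) < i :=
    fun j => (Finset.mem_filter.mp (hB.le j.2)).2.1
  have hupdate : ∀ (j : Fin n) (x : ∀ i, α i) (b : α j) (l : Fin n), i ≤ j → l < i →
      Function.update x j b l = x l :=
    fun j x b l hij hl => Function.update_of_ne (hl.trans_le hij).ne _ _
  obtain rfl : p = fun x => ∏ i : Fin n, k i (fun j : pa i => x j) (x i) := funext hpdef
  have hpa_update : ∀ (j : Fin n) (x : ∀ i, α i) (d : α j), i ≤ j →
      ((∀ l : pa i, Function.update x j d l = c l) ↔ ∀ l : pa i, x l = c l) :=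
    fun j x d hij => forall_congr' fun l => by rw [hupdate j x d l hij (hpa i l l.2)]
  have hB_update : ∀ (j : Fin n) (x : ∀ i, α i) (d : α j), i ≤ j →
      ((∀ l : B, Function.update x j d l = b l) ↔ ∀ l : B, x l = b l) :=
    fun j x d hij => forall_congr' fun l => by rw [hupdate j x d l hij (hB_lt l)]
  rw [BayesNet.sum_filter_and_eq hpa k hk i a c
      (fun x => (∀ j : B, x j = b j) ∧ ∀ j : pa i, x j = c j)
      (fun j x d hij => and_congr (hB_update j x d hij) (hpa_update j x d hij))
      (fun x hx => hx.2),
    BayesNet.sum_filter_and_eq hpa k hk i a c (fun x => ∀ j : pa i, x j = c j) hpa_update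
      (fun x hx => hx), mul_div_cancel_right₀ _ hpos.ne', mul_div_assoc]
end

section
/- In the finite Bayesian network setting, suppose the last index m = n−1 represents the action, so that every other index is smaller than m. Then for every configuration x of all the covariates (indices 0,…,n−2) with p(x) > 0 and every value a of α m, the conditional probability of the action given all covariates equals the conditional probability of the action given its parents alone: p(X_m = a | X_0,…,X_{n−2} = x) = p(X_m = a | X_{pa(m)} = x restricted to pa(m)); moreover both equal k_m(x restricted to pa(m))(a). -/
open scoped NNReal

/-- Among the configurations satisfying an event that does not constrain coordinate `m`, the mass
of a weight that does not depend on coordinate `m` is the same on every slice `y m = a`. -/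
theorem sum_slice_eq_sum_slice {ι : Type*} [DecidableEq ι] [Fintype ι] {α : ι → Type*}
    [∀ i, Fintype (α i)] [∀ i, DecidableEq (α i)] {M : Type*} [AddCommMonoid M] (m : ι)
    (P : (∀ i, α i) → Prop) [DecidablePred P] (hP : ∀ y b, P (Function.update y m b) ↔ P y)
    (w : (∀ i, α i) → M) (hw : ∀ y b, w (Function.update y m b) = w y) (a b : α m) :
    ∑ y ∈ Finset.univ.filter (fun y : ∀ i, α i => y m = a ∧ P y), w y =
      ∑ y ∈ Finset.univ.filter (fun y : ∀ i, α i => y m = b ∧ P y), w y := by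
  refine Finset.sum_bij' (fun y _ => Function.update y m b) (fun y _ => Function.update y m a)
    ?_ ?_ ?_ ?_ ?_
  · intro y hy
    simpa [hP] using (Finset.mem_filter.1 hy).2.2
  · intro y hy
    simpa [hP] using (Finset.mem_filter.1 hy).2.2
  · intro y hy
    simp [← (Finset.mem_filter.1 hy).2.1]
  · intro y hy
    simp [← (Finset.mem_filter.1 hy).2.1]
  · intro y _
    exact (hw y b).symm

/-- If, on an event not constraining coordinate `m`, the weight `p` factors as a weight not
depending on coordinate `m` times a probability vector `q` in that coordinate, then the slice
`y m = a` carries the fraction `q a` of the mass of the event. -/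
theorem sum_slice_eq_mul_sum {ι : Type*} [DecidableEq ι] [Fintype ι] {α : ι → Type*}
    [∀ i, Fintype (α i)] [∀ i, DecidableEq (α i)] {R : Type*} [CommSemiring R] (m : ι)
    (P : (∀ i, α i) → Prop) [DecidablePred P] (hP : ∀ y b, P (Function.update y m b) ↔ P y)
    (w : (∀ i, α i) → R) (hw : ∀ y b, w (Function.update y m b) = w y)
    (q : α m → R) (hq : ∑ a, q a = 1)
    (p : (∀ i, α i) → R) (hp : ∀ y, P y → p y = q (y m) * w y) (a : α m) :
    ∑ y ∈ Finset.univ.filter (fun y : ∀ i, α i => y m = a ∧ P y), p y =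
      q a * ∑ y ∈ Finset.univ.filter P, p y := by
  have slice (b : α m) :
      ∑ y ∈ Finset.univ.filter (fun y : ∀ i, α i => y m = b ∧ P y), p y =
        q b * ∑ y ∈ Finset.univ.filter (fun y : ∀ i, α i => y m = a ∧ P y), w y := by
    rw [sum_slice_eq_sum_slice m P hP w hw a b, Finset.mul_sum]
    refine Finset.sum_congr rfl fun y hy => ?_
    obtain ⟨hyb, hPy⟩ := (Finset.mem_filter.1 hy).2
    rw [hp y hPy, hyb]
  have total : ∑ y ∈ Finset.univ.filter P, p y =
      ∑ y ∈ Finset.univ.filter (fun y : ∀ i, α i => y m = a ∧ P y), w y := by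
    rw [← Finset.sum_fiberwise (Finset.univ.filter P) (fun y => y m) p]
    simp_rw [Finset.filter_filter, and_comm (a := P _), slice, ← Finset.sum_mul, hq, one_mul]
  rw [slice, total]

/-- **The expert policy conditioned on all covariates equals the policy conditioned on the
direct cause.** In the finite Bayesian network setting, let the last index `m = n - 1` be the
action (all other indices are covariates). For every configuration `x` of the covariates of
positive marginal mass and every action value `a : α m`, the conditional probability of
`X_m = a` given all the covariates equals the conditional probability of `X_m = a` given the
parents `pa m` alone, and both equal `k m (x restricted to pa m) a`. -/
theorem bayesNet_policy_condition_on_parents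
    {n : ℕ} (hn : 0 < n)
    {α : Fin n → Type*} [∀ i, Fintype (α i)] [∀ i, Nonempty (α i)] [∀ i, DecidableEq (α i)]
    (pa : Fin n → Finset (Fin n)) (hpa : ∀ i : Fin n, ∀ j ∈ pa i, j < i)
    (k : ∀ i : Fin n, ((j : pa i) → α j) → α i → ℝ≥0)
    (hk : ∀ (i : Fin n) (c : (j : pa i) → α j), ∑ a : α i, k i c a = 1)
    (p : (∀ i, α i) → ℝ≥0)
    (hpdef : ∀ x : ∀ i, α i, p x = ∏ i : Fin n, k i (fun j : pa i => x j) (x i))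
    (m : Fin n) (hm : (m : ℕ) = n - 1)
    (x : ∀ i, α i)
    (hpos : 0 < ∑ y ∈ Finset.univ.filter (fun y : ∀ i, α i => ∀ j, j ≠ m → y j = x j), p y)
    (a : α m) :
    ((∑ y ∈ Finset.univ.filter
        (fun y : ∀ i, α i => y m = a ∧ ∀ j, j ≠ m → y j = x j), p y) /
      (∑ y ∈ Finset.univ.filter (fun y : ∀ i, α i => ∀ j, j ≠ m → y j = x j), p y) =
    (∑ y ∈ Finset.univ.filter
        (fun y : ∀ i, α i => y m = a ∧ ∀ j : pa m, y j = x j), p y) /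
      (∑ y ∈ Finset.univ.filter (fun y : ∀ i, α i => ∀ j : pa m, y j = x j), p y)) ∧
    (∑ y ∈ Finset.univ.filter
        (fun y : ∀ i, α i => y m = a ∧ ∀ j : pa m, y j = x j), p y) /
      (∑ y ∈ Finset.univ.filter (fun y : ∀ i, α i => ∀ j : pa m, y j = x j), p y) =
    k m (fun j : pa m => x j) a := by
  have hne (i : Fin n) (hi : i ≠ m) (j : Fin n) (hj : j ∈ pa i) : j ≠ m := by
    have := hpa i j hj
    omega
  have hpam (j : pa m) : (j : Fin n) ≠ m := (hpa m j j.2).ne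
  let w : (∀ i, α i) → ℝ≥0 := fun y =>
    ∏ i ∈ Finset.univ.erase m, k i (fun j : pa i => y j) (y i)
  have hw (y : ∀ i, α i) (b : α m) : w (Function.update y m b) = w y := by
    refine Finset.prod_congr rfl fun i hi => ?_
    have hi := Finset.ne_of_mem_erase hi
    rw [Function.update_of_ne hi]
    congr 1
    funext j
    exact Function.update_of_ne (hne i hi j j.2) _ _
  have hp (y : ∀ i, α i) (hy : ∀ j : pa m, y j = x j) :
      p y = k m (fun j : pa m => x j) (y m) * w y := by
    rw [hpdef, ← Finset.mul_prod_erase _ _ (Finset.mem_univ m), funext hy]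
  have hall := sum_slice_eq_mul_sum m (fun y : ∀ i, α i => ∀ j, j ≠ m → y j = x j)
    (fun y b => forall₂_congr fun j hj => by rw [Function.update_of_ne hj]) w hw
    _ (hk m fun j => x j) p (fun y hy => hp y fun j => hy j (hpam j)) a
  have hpar := sum_slice_eq_mul_sum m (fun y : ∀ i, α i => ∀ j : pa m, y j = x j)
    (fun y b => forall_congr' fun j => by rw [Function.update_of_ne (hpam j)]) w hw
    _ (hk m fun j => x j) p hp a
  have hpos' : 0 < ∑ y ∈ Finset.univ.filter (fun y : ∀ i, α i => ∀ j : pa m, y j = x j), p y :=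
    hpos.trans_le <| Finset.sum_le_sum_of_subset <|
      Finset.monotone_filter_right _ fun y _ hy j => hy j (hpam j)
  rw [hall, hpar, mul_div_cancel_right₀ _ hpos.ne', mul_div_cancel_right₀ _ hpos'.ne']
  exact ⟨rfl, rfl⟩
end

section
/- In the finite Bayesian network setting, the pairwise Markov property with respect to the moral graph holds: let i ≠ j be indices such that j ∉ pa(i), i ∉ pa(j), and there is no index l with both i ∈ pa(l) and j ∈ pa(l) (i.e., {i, j} is not an edge of the moral graph of the network). Let R be the set of all indices other than i and j. Then under p, X_i and X_j are conditionally independent given (X_r)_{r ∈ R}: for every configuration c of R with marginal p_R(c) > 0 and all values a of α i and b of α j, p(X_i = a, X_j = b | X_R = c) = p(X_i = a | X_R = c) · p(X_j = b | X_R = c). -/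
open scoped NNReal

/-- Summing a function over the configurations with the coordinates outside `{i, j}` fixed by `x₀`
and those at `i`, `j` ranging over `A`, `B`, when the function splits as a product there. -/
theorem sum_filter_eq_mul_of_agree_off_pair
    {ι M : Type*} [Fintype ι] [DecidableEq ι] [CommSemiring M]
    {α : ι → Type*} [∀ i, Fintype (α i)] [∀ i, DecidableEq (α i)]
    {i j : ι} (hij : i ≠ j) (x₀ : ∀ l, α l) (p : (∀ l, α l) → M)
    (f : α i → M) (g : α j → M)
    (hp : ∀ y : ∀ l, α l, (∀ l, l ≠ i → l ≠ j → y l = x₀ l) → p y = f (y i) * g (y j))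
    (A : Finset (α i)) (B : Finset (α j)) (P : (∀ l, α l) → Prop) [DecidablePred P]
    (hP : ∀ y, P y ↔ y i ∈ A ∧ y j ∈ B ∧ ∀ l, l ≠ i → l ≠ j → y l = x₀ l) :
    ∑ y ∈ Finset.univ.filter P, p y = (∑ u ∈ A, f u) * ∑ v ∈ B, g v := by
  rw [Finset.sum_mul_sum, ← Finset.sum_product']
  refine Finset.sum_nbij' (fun y => (y i, y j))
    (fun w => Function.update (Function.update x₀ i w.1) j w.2) ?_ ?_ ?_ ?_ ?_
  · intro y hy
    have := (hP y).1 (Finset.mem_filter.1 hy).2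
    exact Finset.mem_product.2 ⟨this.1, this.2.1⟩
  · intro w hw
    have := Finset.mem_product.1 hw
    refine Finset.mem_filter.2 ⟨Finset.mem_univ _, (hP _).2 ⟨?_, ?_, ?_⟩⟩
    · simpa [hij] using this.1
    · simpa using this.2
    · intro l hli hlj
      simp [hli, hlj]
  · intro y hy
    have hy' := ((hP y).1 (Finset.mem_filter.1 hy).2).2.2
    funext l
    by_cases hlj : l = j
    · subst hlj; simp
    by_cases hli : l = i
    · subst hli; simp [hij]
    simp [hli, hlj, hy' l hli hlj]
  · intro w _
    simp [hij]
  · intro y hy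
    exact hp y ((hP y).1 (Finset.mem_filter.1 hy).2).2.2

/-- If `i` and `j` are not adjacent in the moral graph, the joint weight splits, with all other
coordinates fixed, as a function of the value at `i` times a function of the value at `j`. -/
theorem exists_prod_eq_mul_of_not_moral_adj
    {ι M : Type*} [Fintype ι] [DecidableEq ι] [CommMonoid M]
    {α : ι → Type*} (pa : ι → Finset ι) (k : ∀ i, ((j : pa i) → α j) → α i → M)
    {i j : ι} (hij : i ≠ j) (hji : j ∉ pa i) (hijp : i ∉ pa j)
    (hnochild : ¬ ∃ l, i ∈ pa l ∧ j ∈ pa l) (x₀ : ∀ l, α l) :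
    ∃ (f : α i → M) (g : α j → M), ∀ y : ∀ l, α l, (∀ l, l ≠ i → l ≠ j → y l = x₀ l) →
      ∏ l, k l (fun m : pa l => y m) (y l) = f (y i) * g (y j) := by
  have hcongr : ∀ (l : ι) (y z : ∀ l, α l), (∀ m ∈ pa l, y m = z m) → y l = z l →
      k l (fun m : pa l => y m) (y l) = k l (fun m : pa l => z m) (z l) := by
    intro l y z h h'
    rw [h', funext fun m : pa l => h m m.2]
  refine ⟨fun u => ∏ l with l = i ∨ i ∈ pa l,
      k l (fun m : pa l => Function.update x₀ i u m) (Function.update x₀ i u l),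
    fun v => ∏ l with ¬ (l = i ∨ i ∈ pa l),
      k l (fun m : pa l => Function.update x₀ j v m) (Function.update x₀ j v l), ?_⟩
  intro y hy
  have hagree_i : ∀ m, m ≠ j → y m = Function.update x₀ i (y i) m := by
    intro m hm
    by_cases hmi : m = i
    · subst hmi; simp
    · simp [hmi, hy m hmi hm]
  have hagree_j : ∀ m, m ≠ i → y m = Function.update x₀ j (y j) m := by
    intro m hm
    by_cases hmj : m = j
    · subst hmj; simp
    · simp [hmj, hy m hm hmj]
  rw [← Finset.prod_filter_mul_prod_filter_not Finset.univ (fun l => l = i ∨ i ∈ pa l)]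
  congr 1
  · refine Finset.prod_congr rfl fun l hl => ?_
    have hl' := (Finset.mem_filter.1 hl).2
    refine hcongr l y _ (fun m hm => hagree_i m ?_) (hagree_i l ?_)
    · rintro rfl
      rcases hl' with rfl | hl'
      · exact hji hm
      · exact hnochild ⟨l, hl', hm⟩
    · rintro rfl
      rcases hl' with h | h
      · exact hij h.symm
      · exact hijp h
  · refine Finset.prod_congr rfl fun l hl => ?_
    have hl' := not_or.1 (Finset.mem_filter.1 hl).2
    exact hcongr l y _ (fun m hm => hagree_j m fun h => hl'.2 (h ▸ hm)) (hagree_j l hl'.1)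

/-- **Pairwise Markov property with respect to the moral graph** for finite Bayesian networks.
If `i ≠ j` are indices with `j ∉ pa i`, `i ∉ pa j` and no common child (so `{i, j}` is not an
edge of the moral graph), and `R` is the set of all remaining indices, then under the joint
weight `p` the coordinates `X_i` and `X_j` are conditionally independent given `(X_r)_{r ∈ R}`:
for every configuration `c` of `R` of positive marginal mass and all values `a : α i`,
`b : α j`, `p(X_i = a, X_j = b | X_R = c) = p(X_i = a | X_R = c) * p(X_j = b | X_R = c)`. -/
theorem bayesNet_pairwise_markov_moral_graph
    {n : ℕ} (hn : 0 < n)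
    {α : Fin n → Type*} [∀ i, Fintype (α i)] [∀ i, Nonempty (α i)] [∀ i, DecidableEq (α i)]
    (pa : Fin n → Finset (Fin n)) (hpa : ∀ i : Fin n, ∀ j ∈ pa i, j < i)
    (k : ∀ i : Fin n, ((j : pa i) → α j) → α i → ℝ≥0)
    (hk : ∀ (i : Fin n) (c : (j : pa i) → α j), ∑ a : α i, k i c a = 1)
    (p : (∀ i, α i) → ℝ≥0)
    (hpdef : ∀ x : ∀ i, α i, p x = ∏ i : Fin n, k i (fun j : pa i => x j) (x i))
    (i j : Fin n) (hij : i ≠ j)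
    (hji : j ∉ pa i) (hijp : i ∉ pa j)
    (hnochild : ¬ ∃ l : Fin n, i ∈ pa l ∧ j ∈ pa l)
    (R : Finset (Fin n)) (hR : R = Finset.univ \ {i, j})
    (c : (r : R) → α r)
    (hpos : 0 < ∑ y ∈ Finset.univ.filter (fun y : ∀ i', α i' => ∀ r : R, y r = c r), p y)
    (a : α i) (b : α j) :
    (∑ y ∈ Finset.univ.filter
        (fun y : ∀ i', α i' => y i = a ∧ y j = b ∧ ∀ r : R, y r = c r), p y) /
      (∑ y ∈ Finset.univ.filter (fun y : ∀ i', α i' => ∀ r : R, y r = c r), p y) =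
    ((∑ y ∈ Finset.univ.filter
        (fun y : ∀ i', α i' => y i = a ∧ ∀ r : R, y r = c r), p y) /
      (∑ y ∈ Finset.univ.filter (fun y : ∀ i', α i' => ∀ r : R, y r = c r), p y)) *
    ((∑ y ∈ Finset.univ.filter
        (fun y : ∀ i', α i' => y j = b ∧ ∀ r : R, y r = c r), p y) /
      (∑ y ∈ Finset.univ.filter (fun y : ∀ i', α i' => ∀ r : R, y r = c r), p y)) := by
  obtain ⟨x₀, hx₀, -⟩ := Finset.exists_ne_zero_of_sum_ne_zero hpos.ne'
  have hx₀c : ∀ r : R, x₀ r = c r := (Finset.mem_filter.1 hx₀).2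
  obtain ⟨f, g, hfg⟩ := exists_prod_eq_mul_of_not_moral_adj pa k hij hji hijp hnochild x₀
  have hagree : ∀ y : ∀ l, α l,
      (∀ r : R, y r = c r) ↔ ∀ l, l ≠ i → l ≠ j → y l = x₀ l := by
    intro y
    constructor
    · intro h l hli hlj
      have hl : l ∈ R := by simp [hR, hli, hlj]
      exact (h ⟨l, hl⟩).trans (hx₀c ⟨l, hl⟩).symm
    · rintro h ⟨l, hl⟩
      have hl' : l ≠ i ∧ l ≠ j := by simpa [hR] using hl
      exact (h l hl'.1 hl'.2).trans (hx₀c ⟨l, hl⟩)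
  have hsum := sum_filter_eq_mul_of_agree_off_pair hij x₀ p f g
    fun y hy => (hpdef y).trans (hfg y hy)
  have hall := hsum Finset.univ Finset.univ (fun y => ∀ r : R, y r = c r)
    fun y => by rw [hagree]; simp
  rw [hall] at hpos
  rw [hall,
    hsum {a} {b} (fun y => y i = a ∧ y j = b ∧ ∀ r : R, y r = c r) fun y => by rw [hagree]; simp,
    hsum {a} Finset.univ (fun y => y i = a ∧ ∀ r : R, y r = c r) fun y => by rw [hagree]; simp,
    hsum Finset.univ {b} (fun y => y j = b ∧ ∀ r : R, y r = c r) fun y => by rw [hagree]; simp,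
    Finset.sum_singleton, Finset.sum_singleton]
  have hf := left_ne_zero_of_mul hpos.ne'
  have hg := right_ne_zero_of_mul hpos.ne'
  field_simp
end
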